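/- For γ ∈ (1,2) and m ≥ 2, the matrix −G_γ is strictly diagonally dominant by rows with nonpositive off-diagonal entries: every diagonal entry of −G_γ equals γ > 0, every off-diagonal entry of −G_γ is ≤ 0, and for each row i one has ∑_{j ≠ i} |(G_γ)_{i,j}| < γ = −(G_γ)_{i,i}. -/

import Mathlib

/-- Grünwald coefficient `g_j^(s) = ((-1)^j / j!) * s(s-1)⋯(s-j+1)` (with `g_0 = 1`). -/
noncomputable def grunwald (s : ℝ) (j : ℕ) : ℝ :=
  (-1) ^ j / (Nat.factorial j : ℝ) * ∏ i ∈ Finset.range j, (s - i)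

/-- The `(m-1)×(m-1)` Toeplitz matrix `G_γ` with entries
`(G_γ)_{i,j} = g_{i-j+1}^{(γ)}` for `i - j ≥ -1` and `0` otherwise (0-based indices). -/
noncomputable def Ggamma (γ : ℝ) (m : ℕ) : Matrix (Fin (m - 1)) (Fin (m - 1)) ℝ :=
  fun i j => if (j : ℕ) ≤ (i : ℕ) + 1 then grunwald γ ((i : ℕ) + 1 - (j : ℕ)) else 0

theorem grunwald_zero (s : ℝ) : grunwald s 0 = 1 := by simp [grunwald]

theorem grunwald_one (s : ℝ) : grunwald s 1 = -s := by simp [grunwald]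

theorem grunwald_succ (s : ℝ) (n : ℕ) :
    grunwald s (n + 1) = grunwald s n * ((n - s) / (n + 1)) := by
  unfold grunwald
  rw [Finset.prod_range_succ, Nat.factorial_succ]
  push_cast
  field_simp
  ring

theorem grunwald_succ_eq_mul_sub_one (s : ℝ) (n : ℕ) :
    grunwald s (n + 1) = -s / (n + 1) * grunwald (s - 1) n := by
  unfold grunwald
  have h : ∏ i ∈ Finset.range n, (s - ((i + 1 : ℕ) : ℝ)) =
      ∏ i ∈ Finset.range n, (s - 1 - (i : ℝ)) :=
    Finset.prod_congr rfl fun i _ => by push_cast; ring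
  rw [Finset.prod_range_succ', h, Nat.factorial_succ]
  push_cast
  field_simp
  ring

theorem sum_range_succ_grunwald (s : ℝ) (n : ℕ) :
    ∑ k ∈ Finset.range (n + 1), grunwald s k = grunwald (s - 1) n := by
  induction n with
  | zero => simp [grunwald_zero]
  | succ n ih =>
    rw [Finset.sum_range_succ, ih, grunwald_succ_eq_mul_sub_one, grunwald_succ]
    field_simp
    ring

theorem grunwald_succ_neg {s : ℝ} (h0 : 0 < s) (h1 : s < 1) (n : ℕ) :
    grunwald s (n + 1) < 0 := by
  induction n with
  | zero => simpa [grunwald_one] using h0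
  | succ n ih =>
    rw [grunwald_succ]
    refine mul_neg_of_neg_of_pos ih (div_pos ?_ (by positivity))
    push_cast
    linarith [n.cast_nonneg (α := ℝ)]

theorem grunwald_nonneg_of_ne_one {s : ℝ} (h1 : 1 < s) (h2 : s < 2) {n : ℕ} (hn : n ≠ 1) :
    0 ≤ grunwald s n := by
  rcases n with _ | _ | n
  · simp [grunwald_zero]
  · exact absurd rfl hn
  · rw [grunwald_succ_eq_mul_sub_one]
    refine mul_nonneg_of_nonpos_of_nonpos ?_
      (grunwald_succ_neg (by linarith) (by linarith) n).le
    exact div_nonpos_of_nonpos_of_nonneg (by linarith) (by positivity)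

theorem sum_range_abs_grunwald_lt {s : ℝ} (h1 : 1 < s) (h2 : s < 2) (n : ℕ) :
    ∑ k ∈ Finset.range (n + 2), |grunwald s k| < 2 * s := by
  have h : ∑ k ∈ Finset.range (n + 2), (|grunwald s k| - grunwald s k) = 2 * s := by
    rw [Finset.sum_eq_single_of_mem 1 (by simp)]
    · rw [grunwald_one, abs_neg, abs_of_pos (by linarith)]
      ring
    · intro k _ hk
      rw [abs_of_nonneg (grunwald_nonneg_of_ne_one h1 h2 hk), sub_self]
  rw [Finset.sum_sub_distrib, sum_range_succ_grunwald s (n + 1)] at h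
  linarith [grunwald_succ_neg (s := s - 1) (by linarith) (by linarith) n]

theorem Ggamma_diag (γ : ℝ) (m : ℕ) (i : Fin (m - 1)) : Ggamma γ m i i = -γ := by
  simp [Ggamma, grunwald_one]

theorem Ggamma_nonneg_of_ne {γ : ℝ} (h1 : 1 < γ) (h2 : γ < 2) {m : ℕ} {i j : Fin (m - 1)}
    (hij : i ≠ j) : 0 ≤ Ggamma γ m i j := by
  unfold Ggamma
  split_ifs with h
  · exact grunwald_nonneg_of_ne_one h1 h2 (by have := Fin.val_ne_of_ne hij; omega)
  · exact le_rfl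

theorem sum_abs_Ggamma_le (γ : ℝ) (m : ℕ) (i : Fin (m - 1)) :
    ∑ j, |Ggamma γ m i j| ≤ ∑ k ∈ Finset.range ((i : ℕ) + 2), |grunwald γ k| := by
  rw [← Finset.sum_range_reflect]
  unfold Ggamma
  rw [Fin.sum_univ_eq_sum_range
    (fun j => |if j ≤ (i : ℕ) + 1 then grunwald γ ((i : ℕ) + 1 - j) else 0|)]
  simp only [apply_ite abs, abs_zero, ← Finset.sum_filter]
  refine Finset.sum_le_sum_of_subset_of_nonneg ?_ fun _ _ _ => abs_nonneg _
  intro j hj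
  simp only [Finset.mem_filter, Finset.mem_range] at hj ⊢
  omega

theorem stmt14 (m : ℕ) (hm : 2 ≤ m) (γ : ℝ) (hγ : γ ∈ Set.Ioo (1 : ℝ) 2) :
    (∀ i : Fin (m - 1), (-(Ggamma γ m)) i i = γ) ∧ 0 < γ ∧
    (∀ i j : Fin (m - 1), i ≠ j → (-(Ggamma γ m)) i j ≤ 0) ∧
    (∀ i : Fin (m - 1), ∑ j ∈ Finset.univ.erase i, |Ggamma γ m i j| < γ) := by
  obtain ⟨h1, h2⟩ := hγ
  refine ⟨fun i => by simp [Ggamma_diag], by linarith, fun i j hij => ?_, fun i => ?_⟩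
  · simpa using Ggamma_nonneg_of_ne h1 h2 hij
  · have hsum := Finset.sum_erase_add _ (fun j => |Ggamma γ m i j|) (Finset.mem_univ i)
    rw [Ggamma_diag, abs_neg, abs_of_pos (by linarith)] at hsum
    linarith [sum_abs_Ggamma_le γ m i, sum_range_abs_grunwald_lt h1 h2 i]
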